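/- arXiv:1104.1024 — 2 statements merged into one kernel-verified Lean document; each statement's English description precedes it below -/
import Mathlib

section
/- Assume the base graph G is connected (and bipartite with at least one edge). Let x, y ∈ Σ_n be distinct vertices of G_n, let k = |x∧y|, and decompose the postfixes x̃ = b₁b₂…b_r and ỹ = c₁c₂…c_q into maximal blocks of letters of constant type (each block of type 1 or 2, consecutive blocks of different types), so that r and q count the blocks in x̃ and ỹ respectively. Then the graph distance between x and y in G_n satisfies r + q − 1 ≤ dist_{G_n}(x,y) ≤ r + q + Diam(G) − 2, where Diam(G) is the diameter of G. -/
noncomputable section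
attribute [local instance] Classical.propDecidable

namespace HierGraph

open Finset MeasureTheory ProbabilityTheory

variable {N : ℕ}

/-- The degree of a vertex in a finite simple graph. -/
def degH {α : Type*} [Fintype α] (H : SimpleGraph α) (v : α) : ℕ :=
  (univ.filter fun w => H.Adj v w).card

/-- The length `|x ∧ y|` of the longest common prefix of two words. -/
def prefixLen {n : ℕ} (x y : Fin n → Fin N) : ℕ :=
  (univ.filter fun i : Fin n => ∀ j : Fin n, j ≤ i → x j = y j).card

/-- The postfix of `x` starting at position `k` has constant type
(`t = true` ↔ all its letters lie in `V1`). -/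
def postfixType (V1 : Finset (Fin N)) {n : ℕ} (k : ℕ) (x : Fin n → Fin N) (t : Bool) : Prop :=
  ∀ i : Fin n, k ≤ i.val → (x i ∈ V1 ↔ t = true)

/-- The edge relation of the graph `Gₙ` (loops included): `x = y`, or the two postfixes
after the common prefix have types `{1,2}` and corresponding letters are adjacent in `G`. -/
def EdgeRel (G : SimpleGraph (Fin N)) (V1 : Finset (Fin N)) {n : ℕ} (x y : Fin n → Fin N) :
    Prop :=
  x = y ∨
    ((∃ t : Bool, postfixType V1 (prefixLen x y) x t ∧ postfixType V1 (prefixLen x y) y (!t)) ∧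
      ∀ i : Fin n, prefixLen x y ≤ i.val → G.Adj (x i) (y i))

/-- The degree of a vertex of `Gₙ`, the loop counting `2`. -/
def degGn (G : SimpleGraph (Fin N)) (V1 : Finset (Fin N)) {n : ℕ} (x : Fin n → Fin N) : ℕ :=
  2 + (univ.filter fun y : Fin n → Fin N => y ≠ x ∧ EdgeRel G V1 x y).card

/-- `ℓ(x)`: the length of the longest suffix of `x` of constant (nonzero) type. -/
def ell (V1 : Finset (Fin N)) {n : ℕ} (x : Fin n → Fin N) : ℕ :=
  ((Finset.Icc 1 n).filter fun i =>
    (∀ j : Fin n, n - i ≤ j.val → x j ∈ V1) ∨ ∀ j : Fin n, n - i ≤ j.val → x j ∉ V1).sup id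

/-- `S(x) = Σ_{r=0}^{ℓ(x)-1} Π_{j=1}^{r} deg(x_{n-j})`. -/
def Sx (G : SimpleGraph (Fin N)) (V1 : Finset (Fin N)) {n : ℕ} (hn : 0 < n)
    (x : Fin n → Fin N) : ℕ :=
  ∑ r ∈ Finset.range (ell V1 x), ∏ j ∈ Finset.Icc 1 r, degH G (x ⟨n - 1 - j, by omega⟩)

/-- The simple graph `Gₙ` (loops removed). -/
def GnSimple (G : SimpleGraph (Fin N)) (V1 : Finset (Fin N)) (n : ℕ) :
    SimpleGraph (Fin n → Fin N) :=
  SimpleGraph.fromRel (EdgeRel G V1)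

/-- The diameter of a finite graph: the maximal graph distance. -/
def fdiam {α : Type*} [Fintype α] (H : SimpleGraph α) : ℕ :=
  univ.sup fun p : α × α => H.dist p.1 p.2

/-- The number of maximal constant-type blocks of the postfix of `x` starting at
position `k` (`k < n`). -/
def blockCount (V1 : Finset (Fin N)) {n : ℕ} (k : ℕ) (x : Fin n → Fin N) : ℕ :=
  1 + (univ.filter fun i : Fin n =>
        k ≤ i.val ∧ ∃ h : i.val + 1 < n, ¬((x i ∈ V1) ↔ x ⟨i.val + 1, h⟩ ∈ V1)).card

/-- The left endpoint of the `N`-adic interval `I_x`. -/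
def Ipt {n : ℕ} (x : Fin n → Fin N) : ℝ := ∑ r : Fin n, (x r : ℝ) / (N : ℝ) ^ (r.val + 1)

/-- The `N`-adic interval `I_x ⊆ [0,1]`. -/
def Iset {n : ℕ} (x : Fin n → Fin N) : Set ℝ := Set.Icc (Ipt x) (Ipt x + 1 / (N : ℝ) ^ n)

/-- The level-`n` square `Q_{(x,y)} = I_x × I_y`. -/
def Qset {n : ℕ} (x y : Fin n → Fin N) : Set (ℝ × ℝ) := Iset x ×ˢ Iset y

/-- `Λₙ`: the embedded adjacency matrix of `Gₙ` in the unit square. -/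
def Lam (G : SimpleGraph (Fin N)) (V1 : Finset (Fin N)) (n : ℕ) : Set (ℝ × ℝ) :=
  ⋃ (p : (Fin n → Fin N) × (Fin n → Fin N)) (_ : EdgeRel G V1 p.1 p.2), Qset p.1 p.2

/-- `Λ = ⋂_{n ≥ 1} Λₙ`. -/
def LamInf (G : SimpleGraph (Fin N)) (V1 : Finset (Fin N)) : Set (ℝ × ℝ) :=
  ⋂ (n : ℕ) (_ : 1 ≤ n), Lam G V1 n

/-- The homothety `f_v(a,b) = ((a,b) + v)/N` for `v ∈ Σ₁ × Σ₁`. -/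
def fmap (N : ℕ) (v : Fin N × Fin N) : ℝ × ℝ → ℝ × ℝ :=
  fun p => ((p.1 + (v.1 : ℝ)) / N, (p.2 + (v.2 : ℝ)) / N)

/-- `f_v = f_{v₁} ∘ ⋯ ∘ f_{vₙ}` for a word `v` over `Σ₁ × Σ₁` (identity for the empty word). -/
def fpath {n : ℕ} (v : Fin n → Fin N × Fin N) : ℝ × ℝ → ℝ × ℝ :=
  (List.ofFn fun i => fmap N (v i)).foldr (· ∘ ·) id

/-- The unit square `[0,1]²`. -/
def unitSq : Set (ℝ × ℝ) := Set.Icc (0 : ℝ) 1 ×ˢ Set.Icc (0 : ℝ) 1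

/-- The diagonal `{(t,t) : t ∈ [0,1]}`. -/
def DiagSet : Set (ℝ × ℝ) := (fun t : ℝ => (t, t)) '' Set.Icc (0 : ℝ) 1

/-- `V_dd`, the diagonal vertices of the directed graph `𝒢`. -/
def Vdd (v : Fin N × Fin N) : Prop := v.1 = v.2

/-- `V₁₂`, vertices of `𝒢` coming from edges of `G` directed from `V₁` to `V₂`. -/
def V12 (G : SimpleGraph (Fin N)) (V1 : Finset (Fin N)) (v : Fin N × Fin N) : Prop :=
  v.1 ∈ V1 ∧ v.2 ∉ V1 ∧ G.Adj v.1 v.2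

/-- `V₂₁`, vertices of `𝒢` coming from edges of `G` directed from `V₂` to `V₁`. -/
def V21 (G : SimpleGraph (Fin N)) (V1 : Finset (Fin N)) (v : Fin N × Fin N) : Prop :=
  v.1 ∉ V1 ∧ v.2 ∈ V1 ∧ G.Adj v.1 v.2

/-- Vertices of the directed graph `𝒢`. -/
def calGVert (G : SimpleGraph (Fin N)) (V1 : Finset (Fin N)) (v : Fin N × Fin N) : Prop :=
  Vdd v ∨ V12 G V1 v ∨ V21 G V1 v

/-- Directed edges of `𝒢`: all pairs (loops included) within each of `V_dd`, `V₁₂`, `V₂₁`,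
plus one edge from each vertex of `V_dd` to each vertex of `V₁₂ ∪ V₂₁`. -/
def calGEdge (G : SimpleGraph (Fin N)) (V1 : Finset (Fin N)) (u v : Fin N × Fin N) : Prop :=
  (Vdd u ∧ Vdd v) ∨ (V12 G V1 u ∧ V12 G V1 v) ∨ (V21 G V1 u ∧ V21 G V1 v) ∨
    (Vdd u ∧ (V12 G V1 v ∨ V21 G V1 v))

/-- `v ∈ 𝒫ₙ`: `v` is a directed path of length `n` in `𝒢`. -/
def IsPathCalG (G : SimpleGraph (Fin N)) (V1 : Finset (Fin N)) {n : ℕ}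
    (v : Fin n → Fin N × Fin N) : Prop :=
  (∀ i, calGVert G V1 (v i)) ∧
    ∀ i j : Fin n, (j : ℕ) = (i : ℕ) + 1 → calGEdge G V1 (v i) (v j)

/-- Non-loop edges of `Gₙ`, i.e. edges of `G'ₙ`. -/
def GnEdge' (G : SimpleGraph (Fin N)) (V1 : Finset (Fin N)) {n : ℕ} (x y : Fin n → Fin N) :
    Prop :=
  x ≠ y ∧ EdgeRel G V1 x y

/-- The extra edges `RE(Ĝₙ)`: the two words agree except in the last letter, and the last
letters form an extra edge (an edge of `R`). -/
def REn (R : SimpleGraph (Fin N)) {n : ℕ} (x y : Fin n → Fin N) : Prop :=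
  ∃ h : 0 < n, (∀ i : Fin n, i.val + 1 < n → x i = y i) ∧
    R.Adj (x ⟨n - 1, Nat.sub_lt h Nat.one_pos⟩) (y ⟨n - 1, Nat.sub_lt h Nat.one_pos⟩)

/-- Adjacency in `Ĝₙ`. -/
def hatAdj (G R : SimpleGraph (Fin N)) (V1 : Finset (Fin N)) {n : ℕ} (x y : Fin n → Fin N) :
    Prop :=
  GnEdge' G V1 x y ∨ REn R x y

/-- The graph `Ĝₙ`. -/
def HatGn (G R : SimpleGraph (Fin N)) (V1 : Finset (Fin N)) (n : ℕ) :
    SimpleGraph (Fin n → Fin N) :=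
  SimpleGraph.fromRel (hatAdj G R V1)

/-- Property R: every `x ∈ Σ₁` lies in a triangle having two edges in `E(G)` and
one extra edge (an edge of `R`). -/
def PropertyR (G R : SimpleGraph (Fin N)) : Prop :=
  ∀ x : Fin N, ∃ y z : Fin N,
    (G.Adj x y ∧ G.Adj x z ∧ R.Adj y z) ∨ (G.Adj x y ∧ R.Adj x z ∧ G.Adj y z) ∨
      (R.Adj x y ∧ G.Adj x z ∧ G.Adj y z)

/-- Exactly two of the three edges of the triangle `(x,y,z)` are non-loop edges of `Gₙ`. -/
def exactlyTwoG (G : SimpleGraph (Fin N)) (V1 : Finset (Fin N)) {n : ℕ}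
    (x y z : Fin n → Fin N) : Prop :=
  (GnEdge' G V1 x y ∧ GnEdge' G V1 x z ∧ ¬GnEdge' G V1 y z) ∨
    (GnEdge' G V1 x y ∧ ¬GnEdge' G V1 x z ∧ GnEdge' G V1 y z) ∨
      (¬GnEdge' G V1 x y ∧ GnEdge' G V1 x z ∧ GnEdge' G V1 y z)

/-- `Δₙ¹(x)` (counted over ordered pairs): class-1 regular triangles at `x` in `Ĝₙ`. -/
def numTri1 (G R : SimpleGraph (Fin N)) (V1 : Finset (Fin N)) {n : ℕ} (x : Fin n → Fin N) :
    ℕ :=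
  (univ.filter fun p : (Fin n → Fin N) × (Fin n → Fin N) =>
    GnEdge' G V1 x p.1 ∧ GnEdge' G V1 x p.2 ∧ REn R p.1 p.2).card

/-- `Δₙ²(x)` (counted over ordered pairs): class-2 regular triangles at `x` in `Ĝₙ`. -/
def numTri2 (G R : SimpleGraph (Fin N)) (V1 : Finset (Fin N)) {n : ℕ} (x : Fin n → Fin N) :
    ℕ :=
  (univ.filter fun p : (Fin n → Fin N) × (Fin n → Fin N) =>
    GnEdge' G V1 x p.1 ∧ REn R x p.2 ∧ GnEdge' G V1 p.1 p.2).card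

/-- `Δₙ^{ir}(x)` (counted over ordered pairs): irregular triangles at `x` in `Ĝₙ`. -/
def numTriIr (G R : SimpleGraph (Fin N)) (V1 : Finset (Fin N)) {n : ℕ} (x : Fin n → Fin N) :
    ℕ :=
  (univ.filter fun p : (Fin n → Fin N) × (Fin n → Fin N) =>
    hatAdj G R V1 x p.1 ∧ hatAdj G R V1 x p.2 ∧ hatAdj G R V1 p.1 p.2 ∧
      ¬exactlyTwoG G V1 x p.1 p.2).card

/-- Exactly two of the three edges of the triangle `(x,y,z)` are edges of `G`. -/
def exactlyTwoB (G : SimpleGraph (Fin N)) (x y z : Fin N) : Prop :=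
  (G.Adj x y ∧ G.Adj x z ∧ ¬G.Adj y z) ∨ (G.Adj x y ∧ ¬G.Adj x z ∧ G.Adj y z) ∨
    (¬G.Adj x y ∧ G.Adj x z ∧ G.Adj y z)

/-- `Δ¹(z)` (counted over ordered pairs): class-1 regular triangles at `z` in `Ĝ = G ⊔ R`. -/
def numTri1B (G R : SimpleGraph (Fin N)) (z : Fin N) : ℕ :=
  (univ.filter fun p : Fin N × Fin N => G.Adj z p.1 ∧ G.Adj z p.2 ∧ R.Adj p.1 p.2).card

/-- `Δ²(z)` (counted over ordered pairs): class-2 regular triangles at `z` in `Ĝ = G ⊔ R`. -/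
def numTri2B (G R : SimpleGraph (Fin N)) (z : Fin N) : ℕ :=
  (univ.filter fun p : Fin N × Fin N => G.Adj z p.1 ∧ R.Adj z p.2 ∧ G.Adj p.1 p.2).card

/-- `Δ^{ir}(z)` (counted over ordered pairs): irregular triangles at `z` in `Ĝ = G ⊔ R`. -/
def numTriIrB (G R : SimpleGraph (Fin N)) (z : Fin N) : ℕ :=
  (univ.filter fun p : Fin N × Fin N =>
    (G ⊔ R).Adj z p.1 ∧ (G ⊔ R).Adj z p.2 ∧ (G ⊔ R).Adj p.1 p.2 ∧
      ¬exactlyTwoB G z p.1 p.2).card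

/-- The number of ordered pairs of neighbors of `x` that are adjacent,
i.e. twice the number of triangles containing `x`. -/
def triOrd {α : Type*} [Fintype α] (H : SimpleGraph α) (x : α) : ℕ :=
  (univ.filter fun p : α × α => H.Adj x p.1 ∧ H.Adj x p.2 ∧ H.Adj p.1 p.2).card

/-- The local clustering coefficient
`C_x = #{edges between neighbors of x} / (deg x choose 2)`. -/
def clustering {α : Type*} [Fintype α] (H : SimpleGraph α) (x : α) : ℝ :=
  (triOrd H x : ℝ) / ((degH H x : ℝ) * ((degH H x : ℝ) - 1))

/-- The degree of vertex `i` in the random graph `Gₙʳ` built from the digit variables `D`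
(neighbors `j ≠ i` are counted). -/
def degR (G : SimpleGraph (Fin N)) (V1 : Finset (Fin N)) {n M : ℕ} {Ω : Type*}
    (D : Fin M → Fin n → Ω → Fin N) (i : Fin M) (ω : Ω) : ℕ :=
  (univ.filter fun j : Fin M => j ≠ i ∧
    EdgeRel G V1 (fun k => D i k ω) (fun k => D j k ω)).card

/-- `t_k = (d₁^{k+1} - 1)/(d₁ - 1) + 1`. -/
def tkD (d₁ k : ℕ) : ℝ := ((d₁ : ℝ) ^ (k + 1) - 1) / ((d₁ : ℝ) - 1) + 1

theorem lt_prefixLen_iff {n : ℕ} (x y : Fin n → Fin N) (i : Fin n) :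
    i.val < prefixLen x y ↔ ∀ j ≤ i, x j = y j := by
  constructor
  · intro h
    by_contra hc
    have hsub : (univ.filter fun i : Fin n => ∀ j : Fin n, j ≤ i → x j = y j) ⊆ Finset.Iio i := by
      intro a ha
      simp only [Finset.mem_filter, Finset.mem_univ, true_and] at ha
      rw [Finset.mem_Iio]
      by_contra hle
      exact hc fun j hj => ha j (hj.trans (not_lt.1 hle))
    have := Finset.card_le_card hsub
    rw [Fin.card_Iio] at this
    unfold prefixLen at h
    omega
  · intro h
    have hsub : Finset.Iic i ⊆ (univ.filter fun i : Fin n => ∀ j : Fin n, j ≤ i → x j = y j) := by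
      intro a ha
      rw [Finset.mem_Iic] at ha
      simp only [Finset.mem_filter, Finset.mem_univ, true_and]
      exact fun j hj => h j (hj.trans ha)
    have := Finset.card_le_card hsub
    rw [Fin.card_Iic] at this
    unfold prefixLen
    omega

theorem prefixLen_eq {n : ℕ} {x y : Fin n → Fin N} {p : ℕ} (hp : p < n)
    (h : ∀ i : Fin n, i.val < p → x i = y i) (hne : x ⟨p, hp⟩ ≠ y ⟨p, hp⟩) :
    prefixLen x y = p := by
  have h1 : ¬ p < prefixLen x y := fun hlt =>
    hne ((lt_prefixLen_iff x y ⟨p, hp⟩).1 hlt _ le_rfl)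
  rcases Nat.lt_or_ge (prefixLen x y) p with h2 | h2
  · exact absurd ((lt_prefixLen_iff x y ⟨prefixLen x y, h2.trans hp⟩).2
      fun j hj => h j (lt_of_le_of_lt hj h2)) (lt_irrefl _)
  · omega

theorem eq_of_lt_prefixLen {n : ℕ} {x y : Fin n → Fin N} {i : Fin n}
    (h : i.val < prefixLen x y) : x i = y i :=
  (lt_prefixLen_iff x y i).1 h i le_rfl

theorem exists_prefixLen_ne {n : ℕ} {x y : Fin n → Fin N} (hxy : x ≠ y) :
    ∃ h : prefixLen x y < n, x ⟨prefixLen x y, h⟩ ≠ y ⟨prefixLen x y, h⟩ := by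
  have hlt : prefixLen x y < n := by
    by_contra hc
    exact hxy (funext fun i => eq_of_lt_prefixLen (i.isLt.trans_le (not_lt.1 hc)))
  refine ⟨hlt, fun he => ?_⟩
  refine absurd ((lt_prefixLen_iff x y ⟨prefixLen x y, hlt⟩).2 fun j hj => ?_) (lt_irrefl _)
  rcases hj.lt_or_eq with h | h
  · exact eq_of_lt_prefixLen h
  · rw [h, he]

/-- All letters of `x` from position `k` on have the same type. -/
def IsConstFrom (V1 : Finset (Fin N)) {n : ℕ} (k : ℕ) (x : Fin n → Fin N) : Prop :=
  ∀ i j : Fin n, k ≤ i.val → k ≤ j.val → (x i ∈ V1 ↔ x j ∈ V1)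

theorem GnSimple_adj_iff {G : SimpleGraph (Fin N)} {V1 : Finset (Fin N)}
    (hbip : ∀ a b : Fin N, G.Adj a b → (a ∈ V1 ↔ b ∉ V1)) {n : ℕ} (x y : Fin n → Fin N) :
    (GnSimple G V1 n).Adj x y ↔ ∃ p < n, (∀ i : Fin n, i.val < p → x i = y i) ∧
      IsConstFrom V1 p x ∧ IsConstFrom V1 p y ∧ ∀ i : Fin n, p ≤ i.val → G.Adj (x i) (y i) := by
  have key : ∀ x y : Fin n → Fin N, x ≠ y → EdgeRel G V1 x y →
      ∃ p < n, (∀ i : Fin n, i.val < p → x i = y i) ∧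
      IsConstFrom V1 p x ∧ IsConstFrom V1 p y ∧
        ∀ i : Fin n, p ≤ i.val → G.Adj (x i) (y i) := by
    intro x y hne h
    rcases h with h | ⟨⟨t, hx, hy⟩, hadj⟩
    · exact absurd h hne
    · exact ⟨_, (exists_prefixLen_ne hne).1, fun i hi => eq_of_lt_prefixLen hi,
        fun i j hi hj => (hx i hi).trans (hx j hj).symm,
        fun i j hi hj => (hy i hi).trans (hy j hj).symm, hadj⟩
  rw [GnSimple, SimpleGraph.fromRel_adj]
  constructor
  · rintro ⟨hne, h | h⟩
    · exact key x y hne h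
    · obtain ⟨p, hp, h1, h2, h3, h4⟩ := key y x hne.symm h
      exact ⟨p, hp, fun i hi => (h1 i hi).symm, h3, h2, fun i hi => (h4 i hi).symm⟩
  · rintro ⟨p, hp, heq, hx, -, hadj⟩
    have hne := (hadj ⟨p, hp⟩ le_rfl).ne
    refine ⟨fun h => hne (by rw [h]), Or.inl (Or.inr ?_)⟩
    rw [prefixLen_eq hp heq hne]
    refine ⟨⟨decide (x ⟨p, hp⟩ ∈ V1), fun i hi => ?_, fun i hi => ?_⟩, hadj⟩
    · simpa using hx i ⟨p, hp⟩ hi le_rfl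
    · have h1 := hx i ⟨p, hp⟩ hi le_rfl
      have h2 := hbip _ _ (hadj i hi)
      simp only [Bool.not_eq_true', decide_eq_false_iff_not]
      tauto

/-- The positions of the block boundaries of `x` from position `k` on. -/
def boundaries (V1 : Finset (Fin N)) {n : ℕ} (k : ℕ) (x : Fin n → Fin N) : Finset (Fin n) :=
  univ.filter fun i : Fin n =>
    k ≤ i.val ∧ ∃ h : i.val + 1 < n, ¬((x i ∈ V1) ↔ x ⟨i.val + 1, h⟩ ∈ V1)

theorem mem_boundaries {V1 : Finset (Fin N)} {n k : ℕ} {x : Fin n → Fin N} {i : Fin n} :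
    i ∈ boundaries V1 k x ↔
      k ≤ i.val ∧ ∃ h : i.val + 1 < n, ¬((x i ∈ V1) ↔ x ⟨i.val + 1, h⟩ ∈ V1) := by
  simp [boundaries]

theorem blockCount_eq (V1 : Finset (Fin N)) {n : ℕ} (k : ℕ) (x : Fin n → Fin N) :
    blockCount V1 k x = 1 + (boundaries V1 k x).card := rfl

theorem IsConstFrom.boundaries_eq_empty {V1 : Finset (Fin N)} {n k p : ℕ} {x : Fin n → Fin N}
    (h : IsConstFrom V1 p x) (hpk : p ≤ k) : boundaries V1 k x = ∅ := by
  refine Finset.eq_empty_of_forall_notMem fun i hi => ?_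
  obtain ⟨hk, hn, hne⟩ := mem_boundaries.1 hi
  exact hne (h _ _ (hpk.trans hk) (by simp only; omega))

theorem IsConstFrom.blockCount_eq_one {V1 : Finset (Fin N)} {n k p : ℕ} {x : Fin n → Fin N}
    (h : IsConstFrom V1 p x) (hpk : p ≤ k) : blockCount V1 k x = 1 := by
  rw [blockCount_eq, h.boundaries_eq_empty hpk, Finset.card_empty]

theorem isConstFrom_of_boundaries_eq_empty {V1 : Finset (Fin N)} {n k : ℕ} {x : Fin n → Fin N}
    (h : boundaries V1 k x = ∅) : IsConstFrom V1 k x := by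
  have key : ∀ m : ℕ, ∀ hm : m < n, ∀ hk : k ≤ m, (x ⟨m, hm⟩ ∈ V1 ↔ x ⟨k, by omega⟩ ∈ V1) := by
    intro m hm hk
    induction m, hk using Nat.le_induction with
    | base => exact Iff.rfl
    | succ m hk ih =>
      rw [← ih (by omega)]
      by_contra hc
      have : (⟨m, by omega⟩ : Fin n) ∈ boundaries V1 k x :=
        mem_boundaries.2 ⟨hk, hm, fun h' => hc h'.symm⟩
      simp [h] at this
  exact fun i j hi hj => (key i i.isLt hi).trans (key j j.isLt hj).symm

section

variable {G : SimpleGraph (Fin N)} {V1 : Finset (Fin N)} {n : ℕ}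

theorem blockCount_le_of_adj (hbip : ∀ a b : Fin N, G.Adj a b → (a ∈ V1 ↔ b ∉ V1))
    {x y : Fin n → Fin N} (h : (GnSimple G V1 n).Adj x y) (k : ℕ) :
    blockCount V1 k x ≤ blockCount V1 k y + 1 := by
  obtain ⟨p, hp, heq, hx, hy, hadj⟩ := (GnSimple_adj_iff hbip x y).1 h
  have hsub : boundaries V1 k x ⊆ insert ⟨p - 1, by omega⟩ (boundaries V1 k y) := by
    intro i hi
    obtain ⟨hk, hn, hne⟩ := mem_boundaries.1 hi
    rw [Finset.mem_insert]
    rcases lt_trichotomy (i.val + 1) p with hlt | he | hgt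
    · refine Or.inr (mem_boundaries.2 ⟨hk, hn, ?_⟩)
      rwa [← heq i (by omega), ← heq ⟨i.val + 1, hn⟩ hlt]
    · exact Or.inl (Fin.ext (by simp only; omega))
    · exact absurd (hx _ _ (by omega) (by simp only; omega)) hne
  have := (Finset.card_le_card hsub).trans (Finset.card_insert_le _ _)
  rw [blockCount_eq, blockCount_eq]
  omega

theorem blockCount_eq_one_of_adj_of_ne (hbip : ∀ a b : Fin N, G.Adj a b → (a ∈ V1 ↔ b ∉ V1))
    {x y : Fin n → Fin N} (h : (GnSimple G V1 n).Adj x y) {k : Fin n} (hk : x k ≠ y k) :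
    blockCount V1 k x = 1 ∧ blockCount V1 k y = 1 := by
  obtain ⟨p, hp, heq, hx, hy, hadj⟩ := (GnSimple_adj_iff hbip x y).1 h
  have hpk : p ≤ k.val := not_lt.1 fun hlt => hk (heq k hlt)
  exact ⟨hx.blockCount_eq_one hpk, hy.blockCount_eq_one hpk⟩

theorem blockCount_le_of_walk (hbip : ∀ a b : Fin N, G.Adj a b → (a ∈ V1 ↔ b ∉ V1)) (k : ℕ)
    {x y : Fin n → Fin N} (w : (GnSimple G V1 n).Walk x y) :
    blockCount V1 k y ≤ blockCount V1 k x + w.length := by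
  induction w with
  | nil => simp
  | cons h w ih =>
    have := blockCount_le_of_adj hbip h.symm k
    rw [SimpleGraph.Walk.length_cons]
    omega

theorem blockCount_add_le_of_walk (hbip : ∀ a b : Fin N, G.Adj a b → (a ∈ V1 ↔ b ∉ V1))
    (k : Fin n) {x y : Fin n → Fin N} (w : (GnSimple G V1 n).Walk x y) (hk : x k ≠ y k) :
    blockCount V1 k x + blockCount V1 k y ≤ w.length + 1 := by
  induction w with
  | nil => exact absurd rfl hk
  | @cons u v w' h w ih =>
    rw [SimpleGraph.Walk.length_cons]
    by_cases huv : u k = v k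
    · have := ih (huv ▸ hk)
      have := blockCount_le_of_adj hbip h k
      omega
    · have := blockCount_eq_one_of_adj_of_ne hbip h huv
      have := blockCount_le_of_walk hbip k w
      omega

theorem exists_walk_isConstFrom (hbip : ∀ a b : Fin N, G.Adj a b → (a ∈ V1 ↔ b ∉ V1))
    {f : Fin N → Fin N} (hf : ∀ a, G.Adj a (f a)) (k : ℕ) (x : Fin n → Fin N) :
    ∃ x' : Fin n → Fin N, (∀ i : Fin n, i.val ≤ k → x' i = x i) ∧ IsConstFrom V1 k x' ∧
      ∃ w : (GnSimple G V1 n).Walk x x', w.length + 1 ≤ blockCount V1 k x := by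
  induction hb : (boundaries V1 k x).card using Nat.strong_induction_on generalizing x with
  | _ m ih =>
    rcases (boundaries V1 k x).eq_empty_or_nonempty with hemp | hne
    · exact ⟨x, fun _ _ => rfl, isConstFrom_of_boundaries_eq_empty hemp, .nil, by
        simp [blockCount_eq]⟩
    obtain ⟨i, hi, hmax⟩ := (boundaries V1 k x).exists_max_image id hne
    obtain ⟨hki, hin, hit⟩ := mem_boundaries.1 hi
    have hconst : IsConstFrom V1 (i.val + 1) x := by
      refine isConstFrom_of_boundaries_eq_empty (Finset.eq_empty_of_forall_notMem fun j hj => ?_)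
      obtain ⟨h1, h2⟩ := mem_boundaries.1 hj
      have : j.val ≤ i.val := hmax j (mem_boundaries.2 ⟨by omega, h2⟩)
      omega
    have hft : ∀ a, f a ∈ V1 ↔ a ∉ V1 := fun a => by
      have := hbip _ _ (hf a)
      tauto
    set z : Fin n → Fin N := fun j => if j.val ≤ i.val then x j else f (x j) with hz
    have hz1 : ∀ j : Fin n, j.val ≤ i.val → z j = x j := fun j hj => if_pos hj
    have hz2 : ∀ j : Fin n, i.val < j.val → z j = f (x j) := fun j hj => if_neg (by omega)
    have hadj : (GnSimple G V1 n).Adj x z := by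
      refine (GnSimple_adj_iff hbip x z).2 ⟨i.val + 1, hin,
        fun j hj => (hz1 j (by omega)).symm, hconst, fun a b ha hb => ?_, fun j hj => ?_⟩
      · rw [hz2 a (by omega), hz2 b (by omega), hft, hft, hconst a b ha hb]
      · rw [hz2 j (by omega)]
        exact hf _
    have hsub : boundaries V1 k z ⊂ boundaries V1 k x := by
      refine (Finset.ssubset_iff_of_subset fun j hj => ?_).2 ⟨i, hi, fun hiz => ?_⟩
      · obtain ⟨h1, h2, h3⟩ := mem_boundaries.1 hj
        rcases lt_trichotomy j.val i.val with h | h | h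
        · rw [hz1 _ h.le, hz1 _ (by simp only; omega)] at h3
          exact mem_boundaries.2 ⟨h1, h2, h3⟩
        · rwa [Fin.ext h]
        · rw [hz2 _ h, hz2 _ (by simp only; omega), hft, hft, not_iff_not] at h3
          exact mem_boundaries.2 ⟨h1, h2, h3⟩
      · obtain ⟨-, h2, h3⟩ := mem_boundaries.1 hiz
        rw [hz1 _ le_rfl, hz2 _ (by simp only; omega), hft] at h3
        tauto
    have hcard := Finset.card_lt_card hsub
    obtain ⟨x', hx', hc, w, hw⟩ := ih _ (hb ▸ hcard) z rfl
    refine ⟨x', fun j hj => (hx' j hj).trans (hz1 j (hj.trans hki)), hc, .cons hadj w, ?_⟩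
    rw [SimpleGraph.Walk.length_cons]
    rw [blockCount_eq] at hw ⊢
    omega

theorem even_length_iff (hbip : ∀ a b : Fin N, G.Adj a b → (a ∈ V1 ↔ b ∉ V1)) {a b : Fin N}
    (w : G.Walk a b) : Even w.length ↔ (a ∈ V1 ↔ b ∈ V1) := by
  induction w with
  | nil => simp
  | cons h w ih =>
    have := hbip _ _ h
    rw [SimpleGraph.Walk.length_cons, Nat.even_add_one, ih]
    tauto

theorem exists_walk_length_add_two_mul {f : Fin N → Fin N} (hf : ∀ a, G.Adj a (f a))
    {a b : Fin N} (w : G.Walk a b) (c : ℕ) : ∃ w' : G.Walk a b, w'.length = w.length + 2 * c := by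
  induction c with
  | zero => exact ⟨w, rfl⟩
  | succ c ih =>
    obtain ⟨w', hw'⟩ := ih
    exact ⟨.cons (hf a) (.cons (hf a).symm w'), by
      simp only [SimpleGraph.Walk.length_cons, hw']; omega⟩

theorem exists_walk_of_letterwise (hbip : ∀ a b : Fin N, G.Adj a b → (a ∈ V1 ↔ b ∉ V1))
    {k : ℕ} (hk : k < n) (m : ℕ) {x y : Fin n → Fin N} (hpre : ∀ i : Fin n, i.val < k → x i = y i)
    (hx : IsConstFrom V1 k x)
    (hw : ∀ i : Fin n, k ≤ i.val → ∃ w : G.Walk (x i) (y i), w.length = m) :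
    ∃ w : (GnSimple G V1 n).Walk x y, w.length = m := by
  induction m generalizing x with
  | zero =>
    obtain rfl : x = y := funext fun i => by
      rcases Nat.lt_or_ge i.val k with h | h
      · exact hpre i h
      · obtain ⟨w, hw⟩ := hw i h
        exact SimpleGraph.Walk.eq_of_length_eq_zero hw
    exact ⟨.nil, rfl⟩
  | succ m ih =>
    have hsplit : ∀ {a c : Fin N} (w : G.Walk a c), w.length = m + 1 →
        ∃ b, G.Adj a b ∧ ∃ w' : G.Walk b c, w'.length = m := by
      intro a c w hw
      cases w with
      | nil => simp at hw
      | cons h w => exact ⟨_, h, w, by simpa using hw⟩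
    have hstep : ∀ i : Fin n, ∃ b, (i.val < k → b = x i) ∧
        (k ≤ i.val → G.Adj (x i) b ∧ ∃ w : G.Walk b (y i), w.length = m) := by
      intro i
      rcases Nat.lt_or_ge i.val k with h | h
      · exact ⟨x i, fun _ => rfl, fun h' => by omega⟩
      · obtain ⟨w, hw⟩ := hw i h
        obtain ⟨b, hab, w', hw'⟩ := hsplit w hw
        exact ⟨b, fun h' => by omega, fun _ => ⟨hab, w', hw'⟩⟩
    choose z hz1 hz2 using hstep
    have hz : IsConstFrom V1 k z := fun i j hi hj => by
      have h1 := hbip _ _ (hz2 i hi).1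
      have h2 := hbip _ _ (hz2 j hj).1
      have h3 := hx i j hi hj
      tauto
    have hadj : (GnSimple G V1 n).Adj x z := (GnSimple_adj_iff hbip x z).2
      ⟨k, hk, fun i hi => (hz1 i hi).symm, hx, hz, fun i hi => (hz2 i hi).1⟩
    obtain ⟨w, hw⟩ := ih (fun i hi => (hz1 i hi).trans (hpre i hi)) hz fun i hi => (hz2 i hi).2
    exact ⟨.cons hadj w, by rw [SimpleGraph.Walk.length_cons, hw]⟩

theorem dist_le_fdiam {α : Type*} [Fintype α] (H : SimpleGraph α) (a b : α) :
    H.dist a b ≤ fdiam H :=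
  Finset.le_sup (f := fun p : α × α => H.dist p.1 p.2) (Finset.mem_univ (a, b))

theorem exists_walk_length_le_fdiam (hbip : ∀ a b : Fin N, G.Adj a b → (a ∈ V1 ↔ b ∉ V1))
    (hconn : G.Connected) {f : Fin N → Fin N} (hf : ∀ a, G.Adj a (f a)) {k : ℕ} (hk : k < n)
    {x y : Fin n → Fin N} (hpre : ∀ i : Fin n, i.val < k → x i = y i)
    (hx : IsConstFrom V1 k x) (hy : IsConstFrom V1 k y) :
    ∃ w : (GnSimple G V1 n).Walk x y, w.length ≤ fdiam G := by
  have hdist : ∀ a b, Even (G.dist a b) ↔ (a ∈ V1 ↔ b ∈ V1) := fun a b => by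
    obtain ⟨w, hw⟩ := hconn.exists_walk_length_eq_dist a b
    rw [← hw, even_length_iff hbip w]
  obtain ⟨m, hm, hm', hpar⟩ : ∃ m ≤ fdiam G, fdiam G ≤ m + 1 ∧
      (Even m ↔ (x ⟨k, hk⟩ ∈ V1 ↔ y ⟨k, hk⟩ ∈ V1)) := by
    by_cases h : Even (fdiam G) ↔ (x ⟨k, hk⟩ ∈ V1 ↔ y ⟨k, hk⟩ ∈ V1)
    · exact ⟨_, le_rfl, Nat.le_succ _, h⟩
    · cases hd : fdiam G with
      | zero =>
        have h0 := dist_le_fdiam G (x ⟨k, hk⟩) (y ⟨k, hk⟩)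
        have h1 := hdist (x ⟨k, hk⟩) (y ⟨k, hk⟩)
        rw [hd] at h h0
        rw [Nat.le_zero.1 h0] at h1
        exact absurd h1 h
      | succ d =>
        refine ⟨d, Nat.le_succ _, le_rfl, ?_⟩
        rw [hd, Nat.even_add_one] at h
        tauto
  obtain ⟨w, hw⟩ := exists_walk_of_letterwise hbip hk m hpre hx fun i hi => by
    obtain ⟨w, hw⟩ := hconn.exists_walk_length_eq_dist (x i) (y i)
    have h1 := dist_le_fdiam G (x i) (y i)
    have h2 : Even w.length ↔ Even m := by
      rw [even_length_iff hbip w, hpar, hx i ⟨k, hk⟩ hi le_rfl, hy i ⟨k, hk⟩ hi le_rfl]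
    rw [Nat.even_iff, Nat.even_iff] at h2
    obtain ⟨w', hw'⟩ := exists_walk_length_add_two_mul hf w ((m - w.length) / 2)
    exact ⟨w', by omega⟩
  exact ⟨w, hw.trans_le hm⟩

end

/-- `r + q - 1 ≤ dist_{Gₙ}(x,y) ≤ r + q + Diam(G) - 2`,
where `r`, `q` are the numbers of constant-type blocks of the postfixes of `x`, `y`. -/
theorem statement9 {N : ℕ} (G : SimpleGraph (Fin N)) (V1 : Finset (Fin N))
    (hV1 : V1.Nonempty) (hV2 : V1ᶜ.Nonempty)
    (hbip : ∀ a b : Fin N, G.Adj a b → (a ∈ V1 ↔ b ∉ V1))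
    (hE : G.edgeFinset.Nonempty) (hconn : G.Connected)
    {n : ℕ} (hn : 0 < n) (x y : Fin n → Fin N) (hxy : x ≠ y) :
    blockCount V1 (prefixLen x y) x + blockCount V1 (prefixLen x y) y - 1
        ≤ (GnSimple G V1 n).dist x y ∧
      (GnSimple G V1 n).dist x y
        ≤ blockCount V1 (prefixLen x y) x + blockCount V1 (prefixLen x y) y
            + fdiam G - 2 := by
  obtain ⟨hk, hkne⟩ := exists_prefixLen_ne hxy
  have hnb : ∀ a : Fin N, ∃ b, G.Adj a b := by
    obtain ⟨u, hu⟩ := hV1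
    obtain ⟨v, hv⟩ := hV2
    have : Nontrivial (Fin N) := ⟨u, v, fun h => Finset.mem_compl.1 hv (h ▸ hu)⟩
    intro a
    obtain ⟨b, hb⟩ := exists_ne a
    obtain ⟨w⟩ := hconn.preconnected a b
    cases w with
    | nil => exact absurd rfl hb
    | cons h _ => exact ⟨_, h⟩
  choose f hf using hnb
  obtain ⟨x', hx', hcx, wx, hwx⟩ := exists_walk_isConstFrom hbip hf (prefixLen x y) x
  obtain ⟨y', hy', hcy, wy, hwy⟩ := exists_walk_isConstFrom hbip hf (prefixLen x y) y
  obtain ⟨w, hw⟩ := exists_walk_length_le_fdiam hbip hconn hf hk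
    (fun i hi => by rw [hx' i hi.le, hy' i hi.le, eq_of_lt_prefixLen hi]) hcx hcy
  have hup := SimpleGraph.dist_le ((wx.append w).append wy.reverse)
  simp only [SimpleGraph.Walk.length_append, SimpleGraph.Walk.length_reverse] at hup
  obtain ⟨p, hp⟩ :=
    ((wx.append w).append wy.reverse).reachable.exists_walk_length_eq_dist
  have hlow := blockCount_add_le_of_walk hbip ⟨_, hk⟩ p hkne
  simp only at hlow
  omega


end HierGraph
end
end

section
/- For every n ≥ 1 and every x = (x₁…x_n) ∈ Σ_n: Δ_n¹(x) = S(x)·Δ¹(x_n), Δ_n²(x) = S(x)·Δ²(x_n), and Δ_n^{ir}(x) = Δ^{ir}(x_n), where S(x) = Σ_{r=0}^{ℓ(x)−1} Π_{j=1}^{r} deg(x_{n−j}) and Δ¹(z), Δ²(z), Δ^{ir}(z) denote the corresponding triangle counts at z ∈ Σ₁ in Ĝ. -/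
noncomputable section
attribute [local instance] Classical.propDecidable

namespace HierGraph

open Finset MeasureTheory ProbabilityTheory

variable {N : ℕ}

theorem prefixLen_eq_of_forall_lt {n : ℕ} {x y : Fin n → Fin N} (k : Fin n)
    (h : ∀ i < k, x i = y i) (hk : x k ≠ y k) : prefixLen x y = k := by
  have : (univ.filter fun i : Fin n => ∀ j : Fin n, j ≤ i → x j = y j) = Finset.Iio k := by
    ext i
    simp only [mem_filter, mem_univ, true_and, Finset.mem_Iio]
    refine ⟨fun hi => ?_, fun hi j hj => h j (hj.trans_lt hi)⟩
    by_contra hc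
    exact hk (hi k (not_lt.mp hc))
  rw [prefixLen, this, Fin.card_Iio]

theorem exists_first_ne {n : ℕ} {x y : Fin n → Fin N} (h : x ≠ y) :
    ∃ k : Fin n, (∀ i < k, x i = y i) ∧ x k ≠ y k := by
  obtain ⟨k, hk, hmin⟩ := WellFounded.has_min (wellFounded_lt (α := Fin n))
    {i | x i ≠ y i} (Function.ne_iff.mp h)
  exact ⟨k, fun i hi => not_not.mp fun hc => hmin i hc hi, hk⟩

/-- Non-loop edges of `Gₙ` in terms of the length `k` of the common prefix. -/
theorem gnEdge'_iff_exists_prefix {G : SimpleGraph (Fin N)} {V1 : Finset (Fin N)}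
    (hbip : ∀ a b : Fin N, G.Adj a b → (a ∈ V1 ↔ b ∉ V1)) {m : ℕ}
    (x y : Fin (m + 1) → Fin N) :
    GnEdge' G V1 x y ↔ ∃ k : Fin (m + 1), (∀ i < k, x i = y i) ∧
      ∀ i, k ≤ i → G.Adj (x i) (y i) ∧ (x i ∈ V1 ↔ x (Fin.last m) ∈ V1) := by
  constructor
  · rintro ⟨hne, hE⟩
    obtain ⟨⟨t, hx, -⟩, hadj⟩ := hE.resolve_left hne
    obtain ⟨k, hlt, hk⟩ := exists_first_ne hne
    rw [prefixLen_eq_of_forall_lt k hlt hk] at hx hadj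
    exact ⟨k, hlt, fun i hi => ⟨hadj i hi, (hx i hi).trans (hx _ (Fin.le_last k)).symm⟩⟩
  · rintro ⟨k, hlt, hge⟩
    have hk : x k ≠ y k := (hge k le_rfl).1.ne
    refine ⟨fun h => hk (congrFun h k), Or.inr ?_⟩
    rw [prefixLen_eq_of_forall_lt k hlt hk]
    refine ⟨⟨decide (x (Fin.last m) ∈ V1), fun i hi => ?_, fun i hi => ?_⟩,
      fun i hi => (hge i hi).1⟩
    · simpa using (hge i hi).2
    · have h1 := hbip _ _ (hge i hi).1
      have h2 := (hge i hi).2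
      simp only [Bool.not_eq_true', decide_eq_false_iff_not]
      tauto

/-- The prefixes `w` of the neighbors in `Gₙ` of the word `uc` which share with `u` all but the
last `r` letters. -/
def nbrPrefixes (G : SimpleGraph (Fin N)) {m : ℕ} (u : Fin m → Fin N) (r : ℕ) :
    Finset (Fin m → Fin N) :=
  Fintype.piFinset fun i : Fin m =>
    if i.val + r < m then {u i} else univ.filter fun w => G.Adj (u i) w

/-- The prefixes of the neighbors of `uc` in `Gₙ`. -/
def allNbrPrefixes (G : SimpleGraph (Fin N)) (V1 : Finset (Fin N)) {m : ℕ} (u : Fin m → Fin N)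
    (c : Fin N) : Finset (Fin m → Fin N) :=
  univ.filter fun w => ∃ r ≤ m, (∀ i : Fin m, m ≤ i.val + r → (u i ∈ V1 ↔ c ∈ V1)) ∧
    w ∈ nbrPrefixes G u r

theorem mem_nbrPrefixes {G : SimpleGraph (Fin N)} {m : ℕ} {u w : Fin m → Fin N} {r : ℕ} :
    w ∈ nbrPrefixes G u r ↔
      ∀ i : Fin m, (i.val + r < m → u i = w i) ∧ (m ≤ i.val + r → G.Adj (u i) (w i)) := by
  rw [nbrPrefixes, Fintype.mem_piFinset]
  refine forall_congr' fun i => ?_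
  split_ifs with h
  · simp [h, Nat.not_le.mpr h, eq_comm]
  · simp [h, Nat.not_lt.mp h]

theorem self_mem_allNbrPrefixes (G : SimpleGraph (Fin N)) (V1 : Finset (Fin N)) {m : ℕ}
    (u : Fin m → Fin N) (c : Fin N) : u ∈ allNbrPrefixes G V1 u c := by
  simp only [allNbrPrefixes, mem_filter, mem_univ, true_and, mem_nbrPrefixes]
  exact ⟨0, m.zero_le, fun i hi => absurd i.2 (by omega),
    fun i => ⟨fun _ => trivial, fun hi => absurd i.2 (by omega)⟩⟩

theorem allNbrPrefixes_congr {G : SimpleGraph (Fin N)} {V1 : Finset (Fin N)} {m : ℕ}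
    (u : Fin m → Fin N) {c d : Fin N} (h : c ∈ V1 ↔ d ∈ V1) :
    allNbrPrefixes G V1 u c = allNbrPrefixes G V1 u d := by
  simp only [allNbrPrefixes, h]

theorem gnEdge'_snoc_iff {G : SimpleGraph (Fin N)} {V1 : Finset (Fin N)}
    (hbip : ∀ a b : Fin N, G.Adj a b → (a ∈ V1 ↔ b ∉ V1)) {m : ℕ}
    (u w : Fin m → Fin N) (c a : Fin N) :
    GnEdge' G V1 (Fin.snoc u c : Fin (m + 1) → Fin N) (Fin.snoc w a : Fin (m + 1) → Fin N) ↔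
      w ∈ allNbrPrefixes G V1 u c ∧ G.Adj c a := by
  rw [gnEdge'_iff_exists_prefix hbip]
  simp only [allNbrPrefixes, mem_filter, mem_univ, true_and, mem_nbrPrefixes]
  constructor
  · rintro ⟨k, hlt, hge⟩
    have hk := k.2
    refine ⟨⟨m - k, by omega, fun i hi => ?_, fun i => ⟨fun hi => ?_, fun hi => ?_⟩⟩, ?_⟩
    · simpa using (hge i.castSucc (Fin.le_def.mpr (by simp; omega))).2
    · simpa using hlt i.castSucc (Fin.lt_def.mpr (by simp; omega))
    · simpa using (hge i.castSucc (Fin.le_def.mpr (by simp; omega))).1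
    · simpa using (hge (Fin.last m) (Fin.le_last k)).1
  · rintro ⟨⟨r, hr, htype, h⟩, hca⟩
    refine ⟨⟨m - r, by omega⟩, fun i => ?_, fun i => ?_⟩
    · refine Fin.lastCases (fun hi => ?_) (fun i hi => ?_) i
      · simp only [Fin.lt_def, Fin.val_last] at hi
        omega
      · simpa using (h i).1 (by simp [Fin.lt_def] at hi; omega)
    · refine Fin.lastCases (fun _ => by simpa using hca) (fun i hi => ?_) i
      have hi' : m ≤ i.val + r := by simp [Fin.le_def] at hi; omega
      simpa using ⟨(h i).2 hi', htype i hi'⟩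

theorem gnEdge'_comm {G : SimpleGraph (Fin N)} {V1 : Finset (Fin N)} {n : ℕ}
    (x y : Fin n → Fin N) : GnEdge' G V1 x y ↔ GnEdge' G V1 y x := by
  have key : ∀ x y : Fin n → Fin N, GnEdge' G V1 x y → GnEdge' G V1 y x := by
    rintro x y ⟨hne, hE⟩
    obtain ⟨⟨t, hx, hy⟩, hadj⟩ := hE.resolve_left hne
    have hp : prefixLen y x = prefixLen x y := by simp only [prefixLen, eq_comm]
    refine ⟨hne.symm, Or.inr ?_⟩
    rw [hp]
    exact ⟨⟨!t, hy, by simpa using hx⟩, fun i hi => (hadj i hi).symm⟩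
  exact ⟨key x y, key y x⟩

theorem rEn_snoc_iff {R : SimpleGraph (Fin N)} {m : ℕ} (u w : Fin m → Fin N) (c a : Fin N) :
    REn R (Fin.snoc u c : Fin (m + 1) → Fin N) (Fin.snoc w a : Fin (m + 1) → Fin N) ↔
      u = w ∧ R.Adj c a := by
  have hlast : ∀ h, (⟨m + 1 - 1, h⟩ : Fin (m + 1)) = Fin.last m := fun _ => rfl
  simp only [REn, hlast, Fin.snoc_last]
  constructor
  · rintro ⟨-, h, hR⟩
    exact ⟨funext fun i => by simpa using h i.castSucc (by simp), hR⟩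
  · rintro ⟨rfl, hR⟩
    refine ⟨m.succ_pos, fun i => ?_, hR⟩
    refine Fin.lastCases (fun hi => by simp at hi) (fun i _ => by simp) i

theorem lt_ell_snoc_iff {V1 : Finset (Fin N)} {m : ℕ} (u : Fin m → Fin N) (c : Fin N) (r : ℕ) :
    r < ell V1 (Fin.snoc u c : Fin (m + 1) → Fin N) ↔
      r ≤ m ∧ ∀ i : Fin m, m ≤ i.val + r → (u i ∈ V1 ↔ c ∈ V1) := by
  simp only [ell, Finset.lt_sup_iff, mem_filter, Finset.mem_Icc, id]
  constructor
  · rintro ⟨s, ⟨⟨h1, h2⟩, h⟩, hrs⟩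
    refine ⟨by omega, fun i hi => ?_⟩
    rcases h with h | h
    all_goals
      have hc := h (Fin.last m) (by simp; omega)
      have hu := h i.castSucc (by simp; omega)
      simp only [Fin.snoc_last, Fin.snoc_castSucc] at hc hu
      tauto
  · rintro ⟨hr, h⟩
    refine ⟨r + 1, ⟨⟨by omega, by omega⟩, ?_⟩, r.lt_succ_self⟩
    by_cases hc : c ∈ V1
    · refine Or.inl fun j => Fin.lastCases (fun _ => by simpa using hc) (fun i hi => ?_) j
      simpa using (h i (by simp at hi; omega)).mpr hc
    · refine Or.inr fun j => Fin.lastCases (fun _ => by simpa using hc) (fun i hi => ?_) j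
      simpa using fun hu => hc ((h i (by simp at hi; omega)).mp hu)

theorem card_nbrPrefixes (G : SimpleGraph (Fin N)) {m : ℕ} (u : Fin m → Fin N) (c : Fin N)
    {r : ℕ} (hr : r ≤ m) :
    (nbrPrefixes G u r).card = ∏ j ∈ Finset.Icc 1 r,
      degH G ((Fin.snoc u c : Fin (m + 1) → Fin N) ⟨m + 1 - 1 - j, by omega⟩) := by
  have hcard : (nbrPrefixes G u r).card =
      ∏ i ∈ univ.filter (fun i : Fin m => m ≤ i.val + r), degH G (u i) := by
    rw [nbrPrefixes, Fintype.card_piFinset, Finset.prod_filter]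
    refine Finset.prod_congr rfl fun i _ => ?_
    by_cases h : i.val + r < m
    · simp [h, Nat.not_le.mpr h]
    · simp [h, Nat.not_lt.mp h, degH]
  rw [hcard]
  refine Finset.prod_bij (fun i _ => m - i.val) (fun i hi => ?_) (fun i _ j _ h => ?_)
    (fun j hj => ?_) (fun i hi => ?_)
  · simp only [mem_filter, mem_univ, true_and] at hi
    have := i.2
    rw [Finset.mem_Icc]
    omega
  · have := i.2
    have := j.2
    exact Fin.ext (by omega)
  · rw [Finset.mem_Icc] at hj
    refine ⟨⟨m - j, by omega⟩, by simp; omega, by simp; omega⟩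
  · have hidx : (⟨m + 1 - 1 - (m - i.val), by omega⟩ : Fin (m + 1)) = i.castSucc :=
      Fin.ext (by have := i.2; simp; omega)
    rw [hidx, Fin.snoc_castSucc]

theorem card_allNbrPrefixes (G : SimpleGraph (Fin N)) (V1 : Finset (Fin N)) {m : ℕ}
    (u : Fin m → Fin N) (c : Fin N) :
    (allNbrPrefixes G V1 u c).card =
      Sx G V1 m.succ_pos (Fin.snoc u c : Fin (m + 1) → Fin N) := by
  have hU : allNbrPrefixes G V1 u c =
      (Finset.range (ell V1 (Fin.snoc u c : Fin (m + 1) → Fin N))).biUnion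
        (nbrPrefixes G u) := by
    ext w
    simp only [allNbrPrefixes, mem_filter, mem_univ, true_and, Finset.mem_biUnion,
      Finset.mem_range, lt_ell_snoc_iff, and_assoc]
  have hlt : ∀ r ≤ m, ∀ s < r, ∀ w, w ∈ nbrPrefixes G u r → w ∉ nbrPrefixes G u s := by
    intro r hr s hs w hwr hws
    rw [mem_nbrPrefixes] at hwr hws
    have hadj := (hwr ⟨m - r, by omega⟩).2 (by simp; omega)
    exact hadj.ne ((hws ⟨m - r, by omega⟩).1 (by simp; omega))
  rw [hU, Finset.card_biUnion, Sx]
  · refine Finset.sum_congr rfl fun r hr => ?_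
    exact card_nbrPrefixes G u c ((lt_ell_snoc_iff u c r).mp (Finset.mem_range.mp hr)).1
  · intro r hr s hs hrs
    refine Finset.disjoint_left.mpr fun w hwr hws => ?_
    have hr' := ((lt_ell_snoc_iff u c r).mp (Finset.mem_range.mp hr)).1
    have hs' := ((lt_ell_snoc_iff u c s).mp (Finset.mem_range.mp hs)).1
    rcases lt_or_gt_of_ne hrs with h | h
    · exact hlt s hs' r h w hws hwr
    · exact hlt r hr' s h w hwr hws

theorem numTri1_snoc {G R : SimpleGraph (Fin N)} {V1 : Finset (Fin N)}
    (hbip : ∀ a b : Fin N, G.Adj a b → (a ∈ V1 ↔ b ∉ V1)) {m : ℕ}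
    (u : Fin m → Fin N) (c : Fin N) :
    numTri1 G R V1 (Fin.snoc u c : Fin (m + 1) → Fin N) =
      (allNbrPrefixes G V1 u c).card * numTri1B G R c := by
  rw [numTri1, numTri1B, ← Finset.card_product]
  refine (Finset.card_bij
    (fun q _ => ((Fin.snoc q.1 q.2.1 : Fin (m + 1) → Fin N), Fin.snoc q.1 q.2.2)) ?_ ?_ ?_).symm
  · rintro ⟨w, a, b⟩ h
    simp only [Finset.mem_product, mem_filter, mem_univ, true_and] at h ⊢
    simp only [gnEdge'_snoc_iff hbip, rEn_snoc_iff]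
    tauto
  · rintro ⟨w, a, b⟩ - ⟨w', a', b'⟩ - h
    simp only [Prod.mk.injEq, Fin.snoc_inj] at h ⊢
    tauto
  · rintro ⟨y, z⟩ h
    induction y using Fin.snocCases with | _ w a
    induction z using Fin.snocCases with | _ w' b
    simp only [mem_filter, mem_univ, true_and, gnEdge'_snoc_iff hbip, rEn_snoc_iff] at h
    obtain ⟨h1, h2, rfl, h3⟩ := h
    exact ⟨(w, a, b), by simp [h1, h2, h3], rfl⟩

theorem numTri2_snoc {G R : SimpleGraph (Fin N)} {V1 : Finset (Fin N)}
    (hbip : ∀ a b : Fin N, G.Adj a b → (a ∈ V1 ↔ b ∉ V1)) {m : ℕ}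
    (u : Fin m → Fin N) (c : Fin N) :
    numTri2 G R V1 (Fin.snoc u c : Fin (m + 1) → Fin N) =
      (allNbrPrefixes G V1 u c).card * numTri2B G R c := by
  rw [numTri2, numTri2B, ← Finset.card_product]
  refine (Finset.card_bij
    (fun q _ => ((Fin.snoc q.1 q.2.1 : Fin (m + 1) → Fin N), Fin.snoc u q.2.2)) ?_ ?_ ?_).symm
  · rintro ⟨w, a, b⟩ h
    simp only [Finset.mem_product, mem_filter, mem_univ, true_and] at h ⊢
    obtain ⟨hw, hca, hcb, hab⟩ := h
    have htype : b ∈ V1 ↔ c ∈ V1 := by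
      have h1 := hbip _ _ hca
      have h2 := hbip _ _ hab
      tauto
    rw [gnEdge'_comm (Fin.snoc w a)]
    simp only [gnEdge'_snoc_iff hbip, rEn_snoc_iff, allNbrPrefixes_congr u htype]
    exact ⟨⟨hw, hca⟩, ⟨trivial, hcb⟩, hw, hab.symm⟩
  · rintro ⟨w, a, b⟩ - ⟨w', a', b'⟩ - h
    simp only [Prod.mk.injEq, Fin.snoc_inj] at h ⊢
    tauto
  · rintro ⟨y, z⟩ h
    induction y using Fin.snocCases with | _ w a
    induction z using Fin.snocCases with | _ w' b
    simp only [mem_filter, mem_univ, true_and, gnEdge'_snoc_iff hbip, rEn_snoc_iff] at h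
    obtain ⟨h1, ⟨rfl, h2⟩, -, h3⟩ := h
    exact ⟨(w, a, b), by simp [h1, h2, h3], rfl⟩

theorem numTriIr_snoc {G R : SimpleGraph (Fin N)} {V1 : Finset (Fin N)}
    (hbip : ∀ a b : Fin N, G.Adj a b → (a ∈ V1 ↔ b ∉ V1)) {m : ℕ}
    (u : Fin m → Fin N) (c : Fin N) :
    numTriIr G R V1 (Fin.snoc u c : Fin (m + 1) → Fin N) = numTriIrB G R c := by
  have hprefix : ∀ a b, GnEdge' G V1 (Fin.snoc u a : Fin (m + 1) → Fin N)
      (Fin.snoc u b : Fin (m + 1) → Fin N) ↔ G.Adj a b := fun a b => by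
    rw [gnEdge'_snoc_iff hbip, and_iff_right (self_mem_allNbrPrefixes G V1 u a)]
  have hiff : ∀ a b, (hatAdj G R V1 (Fin.snoc u c : Fin (m + 1) → Fin N)
        (Fin.snoc u a : Fin (m + 1) → Fin N) ∧
      hatAdj G R V1 (Fin.snoc u c : Fin (m + 1) → Fin N)
        (Fin.snoc u b : Fin (m + 1) → Fin N) ∧
      hatAdj G R V1 (Fin.snoc u a : Fin (m + 1) → Fin N)
        (Fin.snoc u b : Fin (m + 1) → Fin N) ∧
      ¬exactlyTwoG G V1 (Fin.snoc u c : Fin (m + 1) → Fin N)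
        (Fin.snoc u a : Fin (m + 1) → Fin N) (Fin.snoc u b : Fin (m + 1) → Fin N)) ↔
      ((G ⊔ R).Adj c a ∧ (G ⊔ R).Adj c b ∧ (G ⊔ R).Adj a b ∧ ¬exactlyTwoB G c a b) :=
    fun a b => by
      simp only [hatAdj, exactlyTwoG, exactlyTwoB, hprefix, rEn_snoc_iff, true_and,
        SimpleGraph.sup_adj]
  rw [numTriIr, numTriIrB]
  refine (Finset.card_bij
    (fun q _ => ((Fin.snoc u q.1 : Fin (m + 1) → Fin N), Fin.snoc u q.2)) ?_ ?_ ?_).symm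
  · rintro ⟨a, b⟩ h
    simp only [mem_filter, mem_univ, true_and] at h ⊢
    exact (hiff a b).mpr h
  · rintro ⟨a, b⟩ - ⟨a', b'⟩ - h
    simp only [Prod.mk.injEq, Fin.snoc_inj] at h ⊢
    tauto
  · rintro ⟨y, z⟩ h
    induction y using Fin.snocCases with | _ w a
    induction z using Fin.snocCases with | _ w' b
    simp only [mem_filter, mem_univ, true_and] at h
    have hw : u = w ∧ u = w' := by
      obtain ⟨h1, h2, h3, h4⟩ := h
      simp only [hatAdj, exactlyTwoG, rEn_snoc_iff] at h1 h2 h3 h4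
      by_cases e1 : GnEdge' G V1 (Fin.snoc u c : Fin (m + 1) → Fin N)
          (Fin.snoc w a : Fin (m + 1) → Fin N) <;>
      by_cases e2 : GnEdge' G V1 (Fin.snoc u c : Fin (m + 1) → Fin N)
          (Fin.snoc w' b : Fin (m + 1) → Fin N) <;>
      by_cases e3 : GnEdge' G V1 (Fin.snoc w a : Fin (m + 1) → Fin N)
          (Fin.snoc w' b : Fin (m + 1) → Fin N)
      · have t1 := hbip _ _ ((gnEdge'_snoc_iff hbip _ _ _ _).mp e1).2
        have t2 := hbip _ _ ((gnEdge'_snoc_iff hbip _ _ _ _).mp e2).2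
        have t3 := hbip _ _ ((gnEdge'_snoc_iff hbip _ _ _ _).mp e3).2
        tauto
      all_goals simp only [e1, e2, e3, true_or, false_or, and_true, not_true_eq_false,
        not_false_eq_true, and_false, or_false, or_true] at h1 h2 h3 h4
      all_goals
        first
        | exact ⟨h1.1, h2.1⟩
        | exact ⟨h1.1, h1.1.trans h3.1⟩
        | exact ⟨h2.1.trans h3.1.symm, h2.1⟩
    obtain ⟨rfl, rfl⟩ := hw
    exact ⟨(a, b), by simpa using (hiff a b).mp h, rfl⟩

/-- `Δₙ¹(x) = S(x)·Δ¹(xₙ)`, `Δₙ²(x) = S(x)·Δ²(xₙ)`,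
`Δₙ^{ir}(x) = Δ^{ir}(xₙ)` (all triangle classes counted over ordered pairs of the two
other vertices, which scales both sides of each identity equally). -/
theorem statement12 {N : ℕ} (G R : SimpleGraph (Fin N)) (V1 : Finset (Fin N))
    (hV1 : V1.Nonempty) (hV2 : V1ᶜ.Nonempty)
    (hbip : ∀ a b : Fin N, G.Adj a b → (a ∈ V1 ↔ b ∉ V1))
    (hdisj : ∀ a b : Fin N, G.Adj a b → ¬R.Adj a b) (hR : PropertyR G R)
    {n : ℕ} (hn : 0 < n) (x : Fin n → Fin N) :
    numTri1 G R V1 x = Sx G V1 hn x * numTri1B G R (x ⟨n - 1, by omega⟩) ∧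
      numTri2 G R V1 x = Sx G V1 hn x * numTri2B G R (x ⟨n - 1, by omega⟩) ∧
        numTriIr G R V1 x = numTriIrB G R (x ⟨n - 1, by omega⟩) := by
  obtain ⟨m, rfl⟩ := Nat.exists_eq_succ_of_ne_zero hn.ne'
  induction x using Fin.snocCases with | _ u c
  have hlast : (Fin.snoc u c : Fin (m + 1) → Fin N) ⟨m + 1 - 1, by omega⟩ = c :=
    Fin.snoc_last (α := fun _ => Fin N) c u
  simp only [Nat.succ_eq_add_one, hlast]
  rw [numTri1_snoc hbip, numTri2_snoc hbip, numTriIr_snoc hbip, card_allNbrPrefixes]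
  exact ⟨rfl, rfl, rfl⟩

end HierGraph
end
end
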